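/- Let S and T be left denominator sets of a ring R with ass(S) ⊆ ass(T), and let ST be the multiplicative sub-semigroup of (R,·) generated by S ∪ T. Then r.ass(ST) := {r ∈ R | rx = 0 for some x ∈ ST} is contained in ass(T). -/

import Mathlib

/-- `S` is a left Ore set of the ring `R`: a multiplicative subset
(`1 ∈ S`, `0 ∉ S`) satisfying the left Ore condition. -/
def LeftOreSet {R : Type*} [Ring R] (S : Set R) : Prop :=
  1 ∈ S ∧ 0 ∉ S ∧ (∀ s ∈ S, ∀ t ∈ S, s * t ∈ S) ∧
  (∀ r : R, ∀ s ∈ S, ∃ s' ∈ S, ∃ r' : R, s' * r = r' * s)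

/-- `ass S = {r ∈ R | s r = 0 for some s ∈ S}`. -/
def assSet {R : Type*} [Ring R] (S : Set R) : Set R := {r : R | ∃ s ∈ S, s * r = 0}

/-- `S` is a left denominator set: a left Ore set such that `r s = 0`
(with `s ∈ S`) implies `t r = 0` for some `t ∈ S`. -/
def LeftDenominatorSet {R : Type*} [Ring R] (S : Set R) : Prop :=
  LeftOreSet S ∧ ∀ r : R, ∀ s ∈ S, r * s = 0 → ∃ t ∈ S, t * r = 0

/-- A maximal element of the poset of left denominator sets of `R`. -/
def MaxLeftDenominatorSet {R : Type*} [Ring R] (S : Set R) : Prop :=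
  LeftDenominatorSet S ∧ ∀ T : Set R, LeftDenominatorSet T → S ⊆ T → T = S

/-- `σ : R → Q` presents `Q` as the left Ore localization `S⁻¹R`:
elements of `S` become units, every element of `Q` is a left fraction
`σ(s)⁻¹ σ(r)`, and the kernel of `σ` is `ass S`. -/
def IsLeftLocalization {R : Type*} [Ring R] (S : Set R) {Q : Type*} [Ring Q]
    (σ : R →+* Q) : Prop :=
  (∀ s ∈ S, IsUnit (σ s)) ∧
  (∀ q : Q, ∃ s ∈ S, ∃ r : R, σ s * q = σ r) ∧
  (∀ r : R, σ r = 0 ↔ r ∈ assSet S)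

/-- The core of a left Ore set `S`: elements `s ∈ S` with `ker (s ·) = ass S`. -/
def coreSet {R : Type*} [Ring R] (S : Set R) : Set R :=
  {s ∈ S | {r : R | s * r = 0} = assSet S}

/-- Elements of the semigroup generated by `S ∪ T` can be cancelled on the right modulo `ass T`. -/
theorem mem_assSet_of_mul_mem_closure {R : Type*} [Ring R] {S T : Set R}
    (hS : LeftDenominatorSet S) (hT : LeftDenominatorSet T)
    (hass : assSet S ⊆ assSet T) {x : R} (hx : x ∈ Subsemigroup.closure (S ∪ T)) :
    ∀ r : R, r * x ∈ assSet T → r ∈ assSet T := by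
  induction hx using Subsemigroup.closure_induction with
  | mem x hx =>
    rintro r ⟨t, ht, htr⟩
    rw [← mul_assoc] at htr
    have key : t * r ∈ assSet T := by
      rcases hx with hx | hx
      · exact hass (hS.2 _ x hx htr)
      · exact hT.2 _ x hx htr
    obtain ⟨u, hu, hur⟩ := key
    exact ⟨u * t, hT.1.2.2.1 u hu t ht, by rw [mul_assoc, hur]⟩
  | mul x y _ _ ihx ihy =>
    intro r hr
    exact ihx r (ihy (r * x) (by rwa [mul_assoc]))

/-- If `S, T` are left denominator sets with `ass S ⊆ ass T` and `ST` is the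
multiplicative sub-semigroup generated by `S ∪ T`, then
`r.ass(ST) = {r | r x = 0 for some x ∈ ST}` is contained in `ass T`. -/
theorem rAss_closure_subset {R : Type*} [Ring R] (S T : Set R)
    (hS : LeftDenominatorSet S) (hT : LeftDenominatorSet T)
    (hass : assSet S ⊆ assSet T) :
    {r : R | ∃ x ∈ Subsemigroup.closure (S ∪ T), r * x = 0} ⊆ assSet T := by
  rintro r ⟨x, hx, hrx⟩
  exact mem_assSet_of_mul_mem_closure hS hT hass hx r ⟨1, hT.1.1, by rw [hrx, mul_zero]⟩
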